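/- Fix a, c ∈ ℝ and an integer M ≥ 1. Then the (M−1)-th iterated derivative of the function x ↦ e^{c x} F_{M−1}(x) equals x ↦ e^{c x} ∑_{i=0}^{M−1} C(M−1, i) · c^i · F_i(x), where F_ν(x) := ∑_{m=0}^∞ a^m x^{m+ν}/(m!(m+ν)!). (This is the key derivative computation Ξ(x) in the proof of the ground-to-air SNR density, combining the Leibniz rule with the Bessel-type derivative identity.) -/

import Mathlib

open Real

/-- `F_ν(x) = ∑_m a^m x^{m+ν} / (m! (m+ν)!)`. -/
noncomputable def Fser (a : ℝ) (ν : ℕ) (x : ℝ) : ℝ :=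
  ∑' m : ℕ, a ^ m * x ^ (m + ν) / ((m.factorial : ℝ) * ((m + ν).factorial : ℝ))

theorem Fser_bound (a : ℝ) (ν : ℕ) (R y : ℝ) (hy : |y| ≤ R) (m : ℕ) :
    ‖a ^ m * y ^ (m + ν) / ((m.factorial : ℝ) * ((m + ν).factorial : ℝ))‖
      ≤ R ^ ν * ((|a| * R) ^ m / (m.factorial : ℝ)) := by
  have hR : 0 ≤ R := (abs_nonneg y).trans hy
  have h1 : (1 : ℝ) ≤ ((m + ν).factorial : ℝ) := by
    exact_mod_cast Nat.succ_le_of_lt (Nat.factorial_pos _)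
  have h0 : (0 : ℝ) < (m.factorial : ℝ) := by exact_mod_cast Nat.factorial_pos _
  rw [Real.norm_eq_abs, abs_div, abs_mul, abs_pow, abs_pow, abs_mul, Nat.abs_cast, Nat.abs_cast]
  calc |a| ^ m * |y| ^ (m + ν) / ((m.factorial : ℝ) * ((m + ν).factorial : ℝ))
      ≤ |a| ^ m * R ^ (m + ν) / ((m.factorial : ℝ) * 1) := by gcongr
    _ = _ := by rw [mul_one, pow_add, mul_pow]; ring

theorem Fser_summable_bound (a : ℝ) (ν : ℕ) (R : ℝ) :
    Summable fun m : ℕ => R ^ ν * ((|a| * R) ^ m / (m.factorial : ℝ)) :=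
  (Real.summable_pow_div_factorial _).mul_left _

theorem Fser_hasDerivAt (a : ℝ) (ν : ℕ) (x : ℝ) :
    HasDerivAt (Fser a (ν + 1)) (Fser a ν x) x := by
  have hx : x ∈ Metric.ball (0 : ℝ) (|x| + 1) := by simp
  refine hasDerivAt_tsum_of_isPreconnected (t := Metric.ball (0 : ℝ) (|x| + 1))
    (g := fun m y => a ^ m * y ^ (m + (ν + 1)) /
      ((m.factorial : ℝ) * ((m + (ν + 1)).factorial : ℝ)))
    (g' := fun m y => a ^ m * y ^ (m + ν) / ((m.factorial : ℝ) * ((m + ν).factorial : ℝ)))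
    (y₀ := x) (Fser_summable_bound a ν (|x| + 1)) Metric.isOpen_ball
    (convex_ball _ _).isPreconnected ?_ ?_ hx ?_ hx
  · intro m y _
    have h := ((hasDerivAt_pow (m + ν + 1) y).const_mul (a ^ m)).div_const
      ((m.factorial : ℝ) * ((m + ν + 1).factorial : ℝ))
    refine h.congr_deriv ?_
    rw [Nat.factorial_succ (m + ν)]
    have h0 : (m.factorial : ℝ) ≠ 0 := by exact_mod_cast Nat.factorial_ne_zero _
    have h1 : ((m + ν).factorial : ℝ) ≠ 0 := by exact_mod_cast Nat.factorial_ne_zero _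
    have h2 : ((m + ν + 1 : ℕ) : ℝ) ≠ 0 := Nat.cast_ne_zero.2 (Nat.succ_ne_zero _)
    rw [Nat.cast_mul, Nat.add_sub_cancel]
    field_simp
  · intro m y hy
    refine Fser_bound a ν _ y ?_ m
    have := mem_ball_zero_iff.1 hy
    exact this.le
  · exact Summable.of_norm_bounded (Fser_summable_bound a (ν + 1) |x|)
      (Fser_bound a (ν + 1) |x| x le_rfl)

theorem Fser_continuous (a : ℝ) (ν : ℕ) : Continuous (Fser a ν) := by
  rw [continuous_iff_continuousAt]
  intro x
  have hx : Metric.ball (0 : ℝ) (|x| + 1) ∈ nhds x :=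
    Metric.isOpen_ball.mem_nhds (by simp)
  refine ContinuousOn.continuousAt (s := Metric.ball (0 : ℝ) (|x| + 1)) ?_ hx
  refine continuousOn_tsum (fun m => ?_) (Fser_summable_bound a ν (|x| + 1)) ?_
  · fun_prop
  · intro m y hy
    exact Fser_bound a ν _ y (mem_ball_zero_iff.1 hy).le m

theorem Fser_deriv (a : ℝ) (ν : ℕ) : deriv (Fser a (ν + 1)) = Fser a ν :=
  funext fun x => (Fser_hasDerivAt a ν x).deriv

theorem Fser_contDiff (a : ℝ) (n : ℕ) : ContDiff ℝ n (Fser a n) := by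
  induction n with
  | zero => exact contDiff_zero.2 (Fser_continuous a 0)
  | succ n ih =>
    rw [Nat.cast_succ, contDiff_succ_iff_deriv]
    refine ⟨fun x => (Fser_hasDerivAt a n x).differentiableAt, by simp, ?_⟩
    rwa [Fser_deriv]

theorem Fser_iteratedDeriv (a : ℝ) (k i : ℕ) : iteratedDeriv k (Fser a (i + k)) = Fser a i := by
  induction k with
  | zero => simp
  | succ k ih => rw [iteratedDeriv_succ', ← add_assoc, Fser_deriv, ih]

/-- Key derivative computation `Ξ(x)`: the `(M−1)`-th iterated derivative of
`x ↦ e^{cx} F_{M−1}(x)` equals `x ↦ e^{cx} ∑_{i=0}^{M−1} C(M−1,i) c^i F_i(x)`. -/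
theorem stmt7 (a c : ℝ) (M : ℕ) (hM : 1 ≤ M) (x : ℝ) :
    iteratedDeriv (M - 1) (fun y : ℝ => Real.exp (c * y) * Fser a (M - 1) y) x
      = Real.exp (c * x) *
          ∑ i ∈ Finset.range M, (Nat.choose (M - 1) i : ℝ) * c ^ i * Fser a i x := by
  obtain ⟨n, rfl⟩ : ∃ n, M = n + 1 := ⟨M - 1, by omega⟩
  rw [Nat.add_sub_cancel]
  have h := iteratedDeriv_mul (n := n) (x := x) (f := fun y : ℝ => Real.exp (c * y))
    (g := Fser a n) (by fun_prop) (Fser_contDiff a n).contDiffAt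
  refine Eq.trans h ?_
  rw [Finset.mul_sum]
  refine Finset.sum_congr rfl fun i hi => ?_
  have hi' : i ≤ n := Nat.lt_succ_iff.1 (Finset.mem_range.1 hi)
  have h2 : iteratedDeriv (n - i) (Fser a n) = Fser a i := by
    have := Fser_iteratedDeriv a (n - i) i
    rwa [Nat.add_sub_cancel' hi'] at this
  rw [h2, iteratedDeriv_exp_const_mul]
  ring
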